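/- If p is an odd prime with p ≡ 2 (mod 3) and x, y, z are nonzero integers such that x^p + y^p + z^p = 0, then 3 divides x, or 3 divides y, or 3 divides z. -/

import Mathlib

theorem Nat.mod_three_eq_one_of_forall_prime {n : ℕ} (hn : n ≠ 0)
    (h : ∀ q : ℕ, q.Prime → q ∣ n → q % 3 = 1) : n % 3 = 1 := by
  induction n using Nat.recOnMul with
  | zero => exact absurd rfl hn
  | one => rfl
  | prime q hq => exact h q hq dvd_rfl
  | mul a b iha ihb =>
    have ha := iha (by rintro rfl; simp at hn) fun q hq hqa => h q hq (hqa.mul_right b)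
    have hb := ihb (by rintro rfl; simp at hn) fun q hq hqb => h q hq (hqb.mul_left a)
    rw [Nat.mul_mod, ha, hb]

/-- A prime other than `3` dividing `a² + ab + b²`, with `a` and `b` coprime, is `1` modulo `3`. -/
theorem Nat.Prime.mod_three_eq_one_of_dvd_sq_add_mul_add_sq {q : ℕ} (hq : q.Prime) (hq3 : q ≠ 3)
    {a b : ℤ} (hab : IsCoprime a b) (h : (q : ℤ) ∣ a ^ 2 + a * b + b ^ 2) : q % 3 = 1 := by
  have : Fact q.Prime := ⟨hq⟩
  have h0 : (a : ZMod q) ^ 2 + a * b + (b : ZMod q) ^ 2 = 0 := by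
    have := (ZMod.intCast_zmod_eq_zero_iff_dvd _ q).2 h
    push_cast at this
    exact this
  have hb : (b : ZMod q) ≠ 0 := by
    intro hb
    have ha : (a : ZMod q) = 0 := by simpa [hb] using h0
    obtain ⟨u, v, huv⟩ := hab
    have := congrArg (Int.cast : ℤ → ZMod q) huv
    simp [ha, hb] at this
  set t : ZMod q := a / b with ht
  have hat : (a : ZMod q) = t * b := by rw [ht]; field_simp
  have h1 : t ^ 2 + t + 1 = 0 := by
    have : (b : ZMod q) ^ 2 * (t ^ 2 + t + 1) = 0 := by
      rw [← h0, hat]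
      ring
    simpa [hb] using this
  have h3 : (3 : ZMod q) ≠ 0 := by
    intro h3
    have : (q : ℕ) ∣ 3 := (ZMod.natCast_eq_zero_iff 3 q).1 (by exact_mod_cast h3)
    exact hq3 ((Nat.prime_dvd_prime_iff_eq hq Nat.prime_three).1 this)
  have ht3 : t ^ 3 = 1 := by linear_combination (t - 1) * h1
  have ht1 : t ≠ 1 := by
    intro ht1
    rw [ht1] at h1
    exact h3 (by linear_combination h1)
  have ht0 : t ≠ 0 := by
    rintro ht0
    simp [ht0] at h1
  have : Fact (Nat.Prime 3) := ⟨Nat.prime_three⟩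
  have hdvd : 3 ∣ q - 1 := by
    rw [← orderOf_eq_prime ht3 ht1]
    exact ZMod.orderOf_dvd_card_sub_one ht0
  have := hq.two_le
  omega

theorem ZMod.eq_of_pow_add_pow_add_pow_eq_zero {p : ℕ} (hp : Odd p) {x y z : ZMod 3}
    (hx : x ≠ 0) (hy : y ≠ 0) (hz : z ≠ 0) (h : x ^ p + y ^ p + z ^ p = 0) : x = y ∧ x = z := by
  have hpow : ∀ t : ZMod 3, t ^ p = t := by
    clear h
    obtain ⟨k, rfl⟩ := hp
    intro t
    induction k with
    | zero => simp
    | succ k ih =>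
      rw [show 2 * (k + 1) + 1 = 2 * k + 1 + 2 by ring, pow_add, ih]
      clear ih
      revert t
      decide
  rw [hpow, hpow, hpow] at h
  revert x y z
  decide

theorem three_dvd_of_pow_add_pow_add_pow_eq_zero {p : ℕ} (hpodd : Odd p) (hpmod : p % 3 = 2)
    {x y z : ℤ} (hxy : IsCoprime x y) (h : x ^ p + y ^ p + z ^ p = 0) :
    (3 : ℤ) ∣ x ∨ (3 : ℤ) ∣ y ∨ (3 : ℤ) ∣ z := by
  by_contra! hcon
  obtain ⟨hx, hy, hz⟩ := hcon
  have cast_ne {t : ℤ} (ht : ¬(3 : ℤ) ∣ t) : (t : ZMod 3) ≠ 0 := fun h0 =>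
    ht ((ZMod.intCast_zmod_eq_zero_iff_dvd t 3).1 h0)
  obtain ⟨hxy3, hxz3⟩ := ZMod.eq_of_pow_add_pow_add_pow_eq_zero hpodd (cast_ne hx) (cast_ne hy)
    (cast_ne hz) (by exact_mod_cast congrArg (Int.cast : ℤ → ZMod 3) h)
  have hx2 : (x : ZMod 3) ^ 2 = 1 := by
    have := cast_ne hx
    generalize (x : ZMod 3) = t at this
    revert t
    decide
  set K : ℤ := ∑ i ∈ Finset.range p, (z ^ 2) ^ i * (x * y) ^ (p - 1 - i) with hK
  have hfac : K * (z ^ 2 - x * y) = (x ^ p) ^ 2 + x ^ p * y ^ p + (y ^ p) ^ 2 := by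
    rw [hK, (Commute.all _ _).geom_sum₂_mul, mul_pow]
    linear_combination (z ^ p - x ^ p - y ^ p) * h
  have hpos : 0 < z ^ 2 - x * y := by
    have hlt : (x * y) ^ p < (z ^ 2) ^ p := by
      have hxp : 0 < (x ^ p) ^ 2 := by
        have : x ≠ 0 := by rintro rfl; simp at hx
        positivity
      have heq : (z ^ 2) ^ p - (x * y) ^ p = (x ^ p) ^ 2 + x ^ p * y ^ p + (y ^ p) ^ 2 := by
        rw [mul_pow]
        linear_combination (z ^ p - x ^ p - y ^ p) * h
      nlinarith [sq_nonneg (x ^ p + 2 * y ^ p)]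
    have := hpodd.strictMono_pow.lt_iff_lt.1 hlt
    linarith
  have hK3 : (K : ZMod 3) = 2 := by
    have hterm : ∀ i ∈ Finset.range p,
        ((z : ZMod 3) ^ 2) ^ i * ((x : ZMod 3) * y) ^ (p - 1 - i) = 1 := fun i _ => by
      rw [← hxz3, ← hxy3, ← sq, hx2, one_pow, one_pow, one_mul]
    rw [hK]
    push_cast
    rw [Finset.sum_congr rfl hterm]
    simp only [Finset.sum_const, Finset.card_range, nsmul_eq_mul, mul_one]
    rw [← ZMod.natCast_mod, hpmod]
    rfl
  have hm3 : (3 : ℤ) ∣ z ^ 2 - x * y := by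
    refine (ZMod.intCast_zmod_eq_zero_iff_dvd _ 3).1 ?_
    push_cast
    rw [← hxz3, ← hxy3]
    ring
  obtain ⟨w, hw⟩ : (3 : ℤ) ∣ x ^ p - y ^ p := by
    refine (ZMod.intCast_zmod_eq_zero_iff_dvd _ 3).1 ?_
    push_cast
    rw [← hxy3, sub_self]
  obtain ⟨m, hm⟩ := hm3
  lift m to ℕ using by omega
  have hKm : K * m = 3 * w ^ 2 + x ^ p * y ^ p := by
    rw [hm] at hfac
    refine mul_left_cancel₀ (three_ne_zero : (3 : ℤ) ≠ 0) ?_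
    linear_combination hfac + (x ^ p - y ^ p + 3 * w) * hw
  have hKm3 : (K : ZMod 3) * (m : ZMod 3) = 1 := by
    have := congrArg (Int.cast : ℤ → ZMod 3) hKm
    push_cast at this
    rw [this, ← hxy3, ← mul_pow, ← sq, hx2, show (3 : ZMod 3) = 0 from rfl]
    simp
  have hm1 : m % 3 = 1 := by
    refine Nat.mod_three_eq_one_of_forall_prime (by omega) fun q hq hqm => ?_
    refine hq.mod_three_eq_one_of_dvd_sq_add_mul_add_sq ?_ (hxy.pow (m := p) (n := p)) ?_
    · rintro rfl
      rw [(ZMod.natCast_eq_zero_iff m 3).2 hqm, mul_zero] at hKm3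
      exact zero_ne_one hKm3
    · rw [← hfac, hm]
      exact ((Int.natCast_dvd_natCast.2 hqm).mul_left 3).mul_left K
  rw [hK3, ← ZMod.natCast_mod, hm1] at hKm3
  exact absurd hKm3 (by decide)

/-- Massoutié–Pomey. If `p` is an odd prime with `p ≡ 2 (mod 3)` and
`x, y, z` are nonzero integers with `x^p + y^p + z^p = 0`, then `3` divides `x`, `y` or `z`. -/
theorem pomey_classical (p : ℕ) (hp : p.Prime) (hpodd : Odd p) (hpmod : p % 3 = 2)
    (x y z : ℤ) (hx : x ≠ 0) (hy : y ≠ 0) (hz : z ≠ 0)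
    (h : x ^ p + y ^ p + z ^ p = 0) :
    (3 : ℤ) ∣ x ∨ (3 : ℤ) ∣ y ∨ (3 : ℤ) ∣ z := by
  obtain ⟨g, x', y', hg, hco, rfl, rfl⟩ := Int.exists_gcd_one' (Int.gcd_pos_of_ne_zero_left y hx)
  have hgz : (g : ℤ) ∣ z := by
    refine (Int.pow_dvd_pow_iff hp.ne_zero).1 ⟨-(x' ^ p + y' ^ p), ?_⟩
    linear_combination h - mul_pow x' (g : ℤ) p - mul_pow y' (g : ℤ) p
  obtain ⟨z', rfl⟩ := hgz
  have h' : x' ^ p + y' ^ p + z' ^ p = 0 := by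
    have : (g : ℤ) ^ p * (x' ^ p + y' ^ p + z' ^ p) = 0 := by
      rw [← h]
      ring
    exact (mul_eq_zero.1 this).resolve_left (by positivity)
  exact (three_dvd_of_pow_add_pow_add_pow_eq_zero hpodd hpmod
    (Int.isCoprime_iff_gcd_eq_one.2 hco) h').imp (·.mul_right _)
    (Or.imp (·.mul_right _) (·.mul_left _))
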